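/- arXiv:1510.07383 — 2 statements merged into one kernel-verified Lean document; each statement's English description precedes it below -/
import Mathlib

section
/- Every walk on Fin 3 of length 11 has a reduction of length 5: for every V : Fin 12 → Fin 3 there exists U : Fin 6 → Fin 3 with U 0 = V 0, U 5 = V 11, and for all p q : Fin 3, the number of indices r ∈ {0,…,4} with U r = p and U (r+1) = q is at most the number of indices s ∈ {0,…,10} with V s = p and V (s+1) = q. -/
/-- The number of steps of the walk `V` that go from `p` to `q`. -/
def edgeCount {n : ℕ} (V : Fin (n + 1) → Fin 3) (p q : Fin 3) : ℕ :=
  (Finset.univ.filter fun s : Fin n => V s.castSucc = p ∧ V s.succ = q).card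

theorem edgeCount_succ {n : ℕ} (V : Fin (n + 2) → Fin 3) (p q : Fin 3) :
    edgeCount V p q =
      (Pi.single (V 0) (Pi.single (V 1) 1) : Fin 3 → Fin 3 → ℕ) p q +
        edgeCount (fun i => V i.succ) p q := by
  unfold edgeCount
  rw [Fin.card_filter_univ_succ]
  simp only [Fin.castSucc_zero, Fin.succ_zero_eq_one, Fin.castSucc_succ, Pi.single_apply]
  by_cases hp : p = V 0
  · subst hp
    by_cases hq : q = V 1
    · simp [hq, add_comm]
    · simp [hq, Ne.symm hq]
  · simp [hp, Ne.symm hp]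

/-- The place value of the edge from `a` to `b` in the hexadecimal encoding of edge counts. -/
def edgeWeight (a b : Fin 3) : ℕ := 16 ^ (3 * a.val + b.val)

/-- The natural number whose hexadecimal digits are the given edge counts. -/
def encode (m : Fin 3 → Fin 3 → ℕ) : ℕ := ∑ a, ∑ b, m a b * edgeWeight a b

theorem encode_div_mod {m : Fin 3 → Fin 3 → ℕ} (hm : ∀ p q, m p q < 16) (a b : Fin 3) :
    encode m / edgeWeight a b % 16 = m a b := by
  have h := fun p => And.intro (hm p 0) (And.intro (hm p 1) (hm p 2))
  have h0 := h 0
  have h1 := h 1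
  have h2 := h 2
  fin_cases a <;> fin_cases b <;> simp [encode, edgeWeight, Fin.sum_univ_three] <;> omega

theorem encode_add_single (m : Fin 3 → Fin 3 → ℕ) (a b : Fin 3) :
    encode (m + Pi.single a (Pi.single b 1)) = encode m + edgeWeight a b := by
  fin_cases a <;> fin_cases b <;> simp [encode, Fin.sum_univ_three] <;> ring

/-- Whether the edge counts encoded by `c` admit a walk of length `k` from `s` to `e`.
The arithmetic avoids type class instances to speed up evaluation in the kernel. -/
def admitsWalk : ℕ → ℕ → Fin 3 → Fin 3 → Bool
  | 0, _, s, e => Nat.beq s.val e.val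
  | k + 1, c, s, e =>
    (Nat.ble 1 (Nat.mod (Nat.div c (edgeWeight s 0)) 16) &&
      admitsWalk k (Nat.sub c (edgeWeight s 0)) 0 e) ||
    ((Nat.ble 1 (Nat.mod (Nat.div c (edgeWeight s 1)) 16) &&
      admitsWalk k (Nat.sub c (edgeWeight s 1)) 1 e) ||
    (Nat.ble 1 (Nat.mod (Nat.div c (edgeWeight s 2)) 16) &&
      admitsWalk k (Nat.sub c (edgeWeight s 2)) 2 e))

theorem exists_walk_of_admitsWalk {k : ℕ} {m : Fin 3 → Fin 3 → ℕ} {s e : Fin 3}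
    (hm : ∀ p q, m p q < 16) (h : admitsWalk k (encode m) s e = true) :
    ∃ U : Fin (k + 1) → Fin 3, U 0 = s ∧ U (Fin.last k) = e ∧
      ∀ p q, edgeCount U p q ≤ m p q := by
  induction k generalizing m s with
  | zero =>
    refine ⟨fun _ => s, rfl, Fin.ext (Nat.eq_of_beq_eq_true h), fun p q => ?_⟩
    simp [edgeCount]
  | succ k ih =>
    obtain ⟨f, hf, hw⟩ : ∃ f, 1 ≤ encode m / edgeWeight s f % 16 ∧
        admitsWalk k (encode m - edgeWeight s f) f e = true := by
      simp only [admitsWalk, Bool.or_eq_true, Bool.and_eq_true, Nat.ble_eq] at h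
      rcases h with h | h | h
      exacts [⟨0, h⟩, ⟨1, h⟩, ⟨2, h⟩]
    rw [encode_div_mod hm] at hf
    obtain ⟨m', rfl⟩ : ∃ m' : Fin 3 → Fin 3 → ℕ,
        m = m' + Pi.single s (Pi.single f 1) := by
      refine ⟨m - (Pi.single s (Pi.single f 1) : Fin 3 → Fin 3 → ℕ),
        (tsub_add_cancel_of_le fun p q => ?_).symm⟩
      by_cases hp : p = s
      · subst hp
        by_cases hq : q = f
        · subst hq
          simpa using hf
        · simp [hq]
      · simp [hp]
    rw [encode_add_single, Nat.add_sub_cancel] at hw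
    obtain ⟨U, hU0, hUe, hU⟩ := ih (fun p q => (Nat.le_add_right _ _).trans_lt (hm p q)) hw
    refine ⟨Fin.cons s U, rfl, by rw [← Fin.succ_last, Fin.cons_succ, hUe], fun p q => ?_⟩
    rw [edgeCount_succ]
    have h1 : (Fin.cons s U : Fin (k + 2) → Fin 3) 1 = f := hU0
    have := Nat.add_le_add_left (hU p q) ((Pi.single s (Pi.single f 1) : Fin 3 → Fin 3 → ℕ) p q)
    simp only [Fin.cons_zero, Fin.cons_succ, h1, Pi.add_apply]
    exact this.trans_eq (add_comm _ _)

/-- Merge the list `a :: l` into a given list, where `rest` merges `l`; entries common to two sorted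
lists are kept once. -/
def mergeCons (a : ℕ) (rest : List ℕ → List ℕ) : List ℕ → List ℕ
  | [] => a :: rest []
  | b :: bs =>
    bif Nat.ble b a then
      bif Nat.beq a b then a :: rest bs else b :: mergeCons a rest bs
    else a :: rest (b :: bs)

/-- Merge two sorted lists without repetition. -/
def mergeDedup (as bs : List ℕ) : List ℕ := as.foldr mergeCons id bs

theorem mem_mergeDedup {x : ℕ} {as bs : List ℕ} (h : x ∈ as ∨ x ∈ bs) :
    x ∈ mergeDedup as bs := by
  induction as generalizing bs with
  | nil => simpa [mergeDedup] using h
  | cons a as iha =>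
    change x ∈ mergeCons a (mergeDedup as) bs
    induction bs with
    | nil =>
      simp only [mergeCons, List.mem_cons] at h ⊢
      grind
    | cons b bs ihb =>
      have e : Nat.beq a b = true → a = b := Nat.eq_of_beq_eq_true
      simp only [mergeCons, List.mem_cons] at h ihb ⊢
      cases Nat.ble b a <;> cases hab : Nat.beq a b <;> simp only [cond_true, cond_false] <;>
        grind

/-- Whether the edge counts encoded by `c` do not admit walks of length 5 from `s` to all ends. -/
def undecided (s : Fin 3) (c : ℕ) : Bool :=
  !(admitsWalk 5 c s 0 && (admitsWalk 5 c s 1 && admitsWalk 5 c s 2))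

/-- The codes of the one-step extensions to `f` of the undecided walks in `S`. -/
def extend (s : Fin 3) (S : Fin 3 → List ℕ) (f : Fin 3) : List ℕ :=
  mergeDedup (((S 0).filter (undecided s)).map (· + edgeWeight 0 f))
    (mergeDedup (((S 1).filter (undecided s)).map (· + edgeWeight 1 f))
      (((S 2).filter (undecided s)).map (· + edgeWeight 2 f)))

theorem mem_extend {s : Fin 3} {S : Fin 3 → List ℕ} {c : ℕ} {a : Fin 3} (f : Fin 3)
    (hc : c ∈ S a) (hu : undecided s c = true) : c + edgeWeight a f ∈ extend s S f := by
  have key : c + edgeWeight a f ∈ ((S a).filter (undecided s)).map (· + edgeWeight a f) :=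
    List.mem_map_of_mem (List.mem_filter.mpr ⟨hc, hu⟩)
  fin_cases a
  · exact mem_mergeDedup (.inl key)
  · exact mem_mergeDedup (.inr (mem_mergeDedup (.inl key)))
  · exact mem_mergeDedup (.inr (mem_mergeDedup (.inr key)))

/-- Whether every extension by `k` steps of a walk from `s` to `a` with code in `S a` has a
reduction of length 5. -/
def checkExtensions (s : Fin 3) : ℕ → (Fin 3 → List ℕ) → Bool
  | 0, S => (S 0).all (admitsWalk 5 · s 0) &&
      ((S 1).all (admitsWalk 5 · s 1) && (S 2).all (admitsWalk 5 · s 2))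
  | k + 1, S => checkExtensions s k ![extend s S 0, extend s S 1, extend s S 2]

theorem exists_admitsWalk_of_checkExtensions {s : Fin 3} {k : ℕ} {S : Fin 3 → List ℕ}
    (h : checkExtensions s k S = true) (m : Fin 3 → Fin 3 → ℕ) (V : Fin (k + 1) → Fin 3)
    (hV : encode m ∈ S (V 0)) :
    ∃ m' : Fin 3 → Fin 3 → ℕ, (∀ p q, m' p q ≤ m p q + edgeCount V p q) ∧
      admitsWalk 5 (encode m') s (V (Fin.last k)) = true := by
  induction k generalizing m S with
  | zero =>
    refine ⟨m, fun p q => Nat.le_add_right _ _, ?_⟩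
    simp only [checkExtensions, Bool.and_eq_true, List.all_eq_true] at h
    obtain ⟨h0, h1, h2⟩ := h
    change admitsWalk 5 (encode m) s (V 0) = true
    generalize V 0 = a at hV
    fin_cases a
    exacts [h0 _ hV, h1 _ hV, h2 _ hV]
  | succ k ih =>
    by_cases hu : undecided s (encode m) = true
    · have hmem := mem_extend (V 1) hV hu
      rw [← encode_add_single] at hmem
      have hS : (![extend s S 0, extend s S 1, extend s S 2] : Fin 3 → List ℕ) = extend s S := by
        ext1 f
        fin_cases f <;> rfl
      rw [checkExtensions, hS] at h
      obtain ⟨m', hm', hw⟩ := ih h _ (fun i => V i.succ) hmem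
      refine ⟨m', fun p q => (hm' p q).trans_eq ?_, hw⟩
      rw [edgeCount_succ, Pi.add_apply, Pi.add_apply, add_assoc]
    · refine ⟨m, fun p q => Nat.le_add_right _ _, ?_⟩
      simp only [undecided, Bool.not_eq_true', Bool.not_eq_false, Bool.and_eq_true] at hu
      obtain ⟨h0, h1, h2⟩ := hu
      generalize V (Fin.last (k + 1)) = a
      fin_cases a
      exacts [h0, h1, h2]

theorem checkExtensions_eleven : checkExtensions 0 11 ![[0], [], []] = true := by
  decide +kernel

/-- Every walk on `Fin 3` of length 11 has a reduction of length 5. -/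
theorem walk_length_eleven_has_reduction_length_five (V : Fin 12 → Fin 3) :
    ∃ U : Fin 6 → Fin 3, U 0 = V 0 ∧ U 5 = V 11 ∧
      ∀ p q : Fin 3,
        (Finset.univ.filter fun r : Fin 5 => U r.castSucc = p ∧ U r.succ = q).card ≤
        (Finset.univ.filter fun s : Fin 11 => V s.castSucc = p ∧ V s.succ = q).card := by
  let W : Fin 12 → Fin 3 := fun i => V i - V 0
  obtain ⟨m, hm, hw⟩ := exists_admitsWalk_of_checkExtensions checkExtensions_eleven 0 W
    (by simp [W, encode])
  simp only [Pi.zero_apply, zero_add] at hm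
  have hlt (p q : Fin 3) : m p q < 16 :=
    ((hm p q).trans (Finset.card_filter_le _ _)).trans_lt (by simp)
  obtain ⟨U, hU0, hUe, hU⟩ := exists_walk_of_admitsWalk hlt hw
  refine ⟨fun i => U i + V 0, by simp [hU0], eq_sub_iff_add_eq.mp hUe, fun p q => ?_⟩
  have := (hU (p - V 0) (q - V 0)).trans (hm _ _)
  simpa only [edgeCount, W, eq_sub_iff_add_eq, sub_add_cancel] using this
end

section
/- Let L be a commutative incline, i.e., L carries a SemilatticeSup structure and a CommSemigroup multiplication satisfying x*(y ⊔ z) = x*y ⊔ x*z and x ⊔ x*y = x for all x, y, z ∈ L. Let n ≥ 2, let V : Fin (l+1) → Fin n and U : Fin (h+1) → Fin n be walks with l ≥ 1, h ≥ 1, U 0 = V 0, U h = V l, and suppose U is a reduction of V, i.e., for all p q : Fin n the number of indices r ∈ {0,…,h-1} with U r = p, U (r+1) = q is at most the number of indices s ∈ {0,…,l-1} with V s = p, V (s+1) = q. Then for every matrix A : Fin n → Fin n → L, the product of the entries of A along V is less than or equal to the product along U: ∏_{s=0}^{l-1} A (V s) (V (s+1)) ≤ ∏_{r=0}^{h-1}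 A (U r) (U (r+1)). -/
/-- The product of the entries of a matrix `A` along a walk of positive length `l + 1`
on `Fin n` (a walk of length `l + 1` being a function `Fin (l + 2) → Fin n`):
`A (V 0) (V 1) * A (V 1) (V 2) * ⋯ * A (V l) (V (l+1))`. -/
def walkProd {L : Type*} [Mul L] {n : ℕ} (A : Fin n → Fin n → L) :
    {l : ℕ} → (Fin (l + 2) → Fin n) → L
  | 0, V => A (V 0) (V 1)
  | l + 1, V => A (V 0) (V 1) * walkProd A (fun t : Fin (l + 2) => V t.succ)

/-- The multiset of directed edges traversed by a walk. -/
def walkEdges {n l : ℕ} (V : Fin (l + 2) → Fin n) : Multiset (Fin n × Fin n) :=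
  (Finset.univ : Finset (Fin (l + 1))).val.map fun s => (V s.castSucc, V s.succ)

theorem count_walkEdges {n l : ℕ} (V : Fin (l + 2) → Fin n) (p q : Fin n) :
    (walkEdges V).count (p, q) =
      (Finset.univ.filter fun s : Fin (l + 1) => V s.castSucc = p ∧ V s.succ = q).card := by
  simp only [walkEdges, Multiset.count_map, Finset.card_def, Finset.filter_val, Prod.mk.injEq,
    eq_comm]

theorem coe_walkProd {L : Type*} [CommSemigroup L] {n : ℕ} (A : Fin n → Fin n → L) {l : ℕ}
    (V : Fin (l + 2) → Fin n) :
    ((walkProd A V : L) : WithOne L) =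
      ((walkEdges V).map fun e => ((A e.1 e.2 : L) : WithOne L)).prod := by
  have key : ((walkProd A V : L) : WithOne L) =
      ∏ s : Fin (l + 1), ((A (V s.castSucc) (V s.succ) : L) : WithOne L) := by
    induction l with
    | zero => simp [walkProd]
    | succ l ih =>
      rw [walkProd, WithOne.coe_mul, ih, Fin.prod_univ_succ (n := l + 1)]
      rfl
  rw [key, walkEdges, Multiset.map_map]
  rfl

/-- In a commutative incline, if the walk `U` (of length `h + 1 ≥ 1`) is a
reduction of the walk `V` (of length `l + 1 ≥ 1`), then for any matrix `A` the product of
the entries of `A` along `V` is less than or equal to the product along `U`. -/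
theorem walkProd_le_of_reduction
    {L : Type*} [SemilatticeSup L] [CommSemigroup L]
    (hdist : ∀ x y z : L, x * (y ⊔ z) = x * y ⊔ x * z)
    (habs : ∀ x y : L, x ⊔ x * y = x)
    (n : ℕ) (hn : 2 ≤ n) (l h : ℕ)
    (V : Fin (l + 2) → Fin n) (U : Fin (h + 2) → Fin n)
    (h0 : U 0 = V 0) (hlast : U (Fin.last (h + 1)) = V (Fin.last (l + 1)))
    (hred : ∀ p q : Fin n,
      (Finset.univ.filter fun r : Fin (h + 1) => U r.castSucc = p ∧ U r.succ = q).card ≤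
      (Finset.univ.filter fun s : Fin (l + 1) => V s.castSucc = p ∧ V s.succ = q).card)
    (A : Fin n → Fin n → L) :
    walkProd A V ≤ walkProd A U := by
  have hle : walkEdges U ≤ walkEdges V := Multiset.le_iff_count.2 fun ⟨p, q⟩ => by
    simpa only [count_walkEdges] using hred p q
  obtain ⟨K, hK⟩ := Multiset.le_iff_exists_add.1 hle
  have hprod := coe_walkProd A V
  rw [hK, Multiset.map_add, Multiset.prod_add, ← coe_walkProd] at hprod
  generalize (K.map fun e => ((A e.1 e.2 : L) : WithOne L)).prod = k at hprod
  induction k using WithOne.recOneCoe with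
  | one => exact (WithOne.coe_inj.1 (hprod.trans (mul_one _))).le
  | coe y =>
    rw [← WithOne.coe_mul, WithOne.coe_inj] at hprod
    rw [hprod]
    exact sup_eq_left.1 (habs _ y)
end
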